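/- Under the standing assumptions, m is odd. -/

import Mathlib

/-- The Lucas-type quotient `(x^n - y^n)/(x - y)`, defined recursively. -/
def lucU (x y : ℕ) : ℕ → ℕ
  | 0 => 0
  | n + 1 => x * lucU x y n + y ^ n

lemma lucU_spec (y e n : ℕ) : (y + e) ^ n = y ^ n + e * lucU (y + e) y n := by
  induction n with
  | zero => simp [lucU]
  | succ n ih =>
    rw [lucU, pow_succ, ih]
    ring_nf

lemma lucU_eq (x y n : ℕ) (h : y < x) : (x ^ n - y ^ n) / (x - y) = lucU x y n := by
  obtain ⟨e, rfl⟩ := Nat.exists_eq_add_of_lt h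
  have := lucU_spec y (e + 1) n
  rw [← add_assoc] at this
  rw [this, Nat.add_sub_cancel_left, show y + e + 1 - y = e + 1 by omega]
  exact Nat.mul_div_cancel_left _ (by omega)

lemma lucU_scale (d x y n : ℕ) :
    lucU (d * x) (d * y) (n + 1) = d ^ n * lucU x y (n + 1) := by
  induction n with
  | zero => simp [lucU]
  | succ n ih =>
    rw [lucU, ih, lucU.eq_2 x y (n + 1)]
    ring

lemma lucU_double (x y k : ℕ) (h : y < x) :
    lucU x y (2 * k) = lucU x y k * (x ^ k + y ^ k) := by
  obtain ⟨e, rfl⟩ := Nat.exists_eq_add_of_lt h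
  have h1 := lucU_spec y (e + 1) k
  have h2 := lucU_spec y (e + 1) (2 * k)
  rw [← add_assoc] at h1 h2
  have : (e + 1) * lucU (y + e + 1) y (2 * k) =
      (e + 1) * (lucU (y + e + 1) y k * ((y + e + 1) ^ k + y ^ k)) := by
    rw [two_mul, pow_add, pow_add] at h2
    rw [two_mul]
    generalize (y + e + 1) ^ k = A at *
    generalize y ^ k = B at *
    generalize lucU (y + e + 1) y k = C at *
    subst h1
    nlinarith
  exact Nat.eq_of_mul_eq_mul_left (by omega) this

lemma lucU_ge (x y n : ℕ) (hx : 0 < x) : x + y ≤ lucU x y (n + 2) := by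
  induction n with
  | zero => simp [lucU]
  | succ n ih =>
    rw [lucU]
    nlinarith [Nat.zero_le (y ^ (n + 2))]

lemma lucU_odd (x y : ℕ) (h : ¬ (Even x ∧ Even y)) (k : ℕ) : Odd (lucU x y (2 * k + 1)) := by
  induction k with
  | zero => simp [lucU]
  | succ k ih =>
    rw [show 2 * (k + 1) + 1 = (2 * k + 1) + 1 + 1 by ring, lucU, lucU]
    by_cases h1 : Even x <;> by_cases h2 : Even y <;>
      simp_all [← Nat.not_even_iff_odd, Nat.even_add, Nat.even_mul, Nat.even_pow]

lemma odd_prime_pow (Q : ℕ) (hQ : Odd Q) (h1 : Q ≠ 1) (h4 : ¬ 4 ∣ Q.totient) :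
    ∃ p b, p.Prime ∧ Odd p ∧ Q = p ^ b := by
  have hp := Nat.minFac_prime h1
  have hd := Nat.minFac_dvd Q
  set p := Q.minFac
  have hpo : Odd p := Odd.of_dvd_nat hQ hd
  have hQ0 : Q ≠ 0 := by rintro rfl; simp at hQ
  obtain ⟨b, Q', hnd, he⟩ := Nat.exists_eq_pow_mul_and_not_dvd hQ0 p hp.ne_one
  refine ⟨p, b, hp, hpo, ?_⟩
  have hb : b ≠ 0 := by
    rintro rfl
    apply hnd
    rw [pow_zero, one_mul] at he
    exact he ▸ hd
  have hQ' : Odd Q' := Odd.of_dvd_nat hQ ⟨p ^ b, by rw [mul_comm]; exact he⟩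
  by_cases h : Q' = 1
  · rw [he, h, mul_one]
  exfalso
  have h3 : 2 < Q' := by
    obtain ⟨r, hr⟩ := hQ'; omega
  have hp3 : 2 < p := by
    have := hp.two_le; obtain ⟨r, hr⟩ := hpo; omega
  have e1 := Nat.totient_even h3
  have e2 : Even (p ^ b).totient := Nat.totient_even (lt_of_lt_of_le hp3 (Nat.le_self_pow hb p))
  apply h4
  have hc : Nat.Coprime (p ^ b) Q' := Nat.Coprime.pow_left _ ((Nat.Prime.coprime_iff_not_dvd hp).2 hnd)
  rw [he, Nat.totient_mul hc]
  exact mul_dvd_mul e2.two_dvd e1.two_dvd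

lemma key (R T V : ℕ) (hR : 0 < R) (hT : 3 ≤ T) (hV : Odd V)
    (h : (R * T).totient = R * V) :
    Even R ∧ ∃ p c, p.Prime ∧ Odd p ∧ T = p ^ (c + 1) ∧ p ^ c * (p - 1) = 2 * V := by
  have hN : R * T ≠ 0 := by positivity
  obtain ⟨a, Q, hQ, he⟩ := Nat.exists_eq_two_pow_mul_odd hN
  have hc : Nat.Coprime (2 ^ a) Q := Nat.Coprime.pow_left _ (Nat.coprime_two_left.2 hQ)
  have hRe : Even R := by
    have : Even (R * T).totient := Nat.totient_even (by nlinarith)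
    rw [h, Nat.even_mul] at this
    rcases this with h | h
    · exact h
    · exact absurd h (Nat.not_even_iff_odd.2 hV)
  refine ⟨hRe, ?_⟩
  have ha : a ≠ 0 := by
    rintro rfl
    rw [pow_zero, one_mul] at he
    rw [← he] at hQ
    exact (Nat.not_even_iff_odd.2 hQ) (hRe.mul_right T)
  obtain ⟨a, rfl⟩ := Nat.exists_eq_succ_of_ne_zero ha
  have ht : 2 ^ a * Q.totient = R * V := by
    rw [← h, he, Nat.totient_mul hc, Nat.totient_prime_pow_succ Nat.prime_two]; simp
  by_cases hQ1 : Q = 1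
  · subst hQ1
    exfalso
    simp only [Nat.totient_one, mul_one] at ht he
    have hV1 : V = 1 := by
      have : V ∣ 2 ^ a := ⟨R, by rw [ht, mul_comm]⟩
      exact Nat.Coprime.eq_one_of_dvd
        (Nat.Coprime.pow_right _ (Nat.coprime_two_right.2 hV)) this
    subst hV1
    rw [Nat.succ_eq_add_one, pow_succ, ht] at he
    nlinarith
  have hQ3 : 2 < Q := by
    obtain ⟨r, hr⟩ := hQ; omega
  obtain ⟨f, hf⟩ := (Nat.totient_even hQ3).two_dvd
  have hRd : 2 ^ (a + 1) ∣ R := by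
    have : 2 ^ (a + 1) ∣ R * V := ⟨f, by rw [← ht, hf]; ring⟩
    exact Nat.Coprime.dvd_of_dvd_mul_right
      (Nat.Coprime.pow_left _ (Nat.coprime_two_left.2 hV)) this
  obtain ⟨R', rfl⟩ := hRd
  have hQe : R' * T = Q := by
    apply Nat.eq_of_mul_eq_mul_left (show 0 < 2 ^ (a + 1) by positivity)
    rw [← mul_assoc]; exact he
  have hte : Q.totient = 2 * (R' * V) := by
    apply Nat.eq_of_mul_eq_mul_left (show 0 < 2 ^ a by positivity)
    rw [ht]; ring
  have hR'o : Odd R' := Odd.of_dvd_nat hQ ⟨T, hQe.symm⟩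
  have h4 : ¬ 4 ∣ Q.totient := by
    rw [hte]
    obtain ⟨r, hr⟩ := hR'o.mul hV
    omega
  obtain ⟨p, b, hp, hpo, hQp⟩ := odd_prime_pow Q hQ hQ1 h4
  have hTd : T ∣ p ^ b := ⟨R', by rw [← hQp, ← hQe, mul_comm]⟩
  have hRd : R' ∣ p ^ b := ⟨T, by rw [← hQp, ← hQe]⟩
  obtain ⟨c, -, rfl⟩ := (Nat.dvd_prime_pow hp).1 hTd
  obtain ⟨s, -, rfl⟩ := (Nat.dvd_prime_pow hp).1 hRd
  have hc0 : c ≠ 0 := by rintro rfl; simp at hT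
  obtain ⟨c, rfl⟩ := Nat.exists_eq_succ_of_ne_zero hc0
  refine ⟨p, c, hp, hpo, rfl, ?_⟩
  have : Q = p ^ (s + c + 1) := by rw [← hQe, Nat.succ_eq_add_one]; ring
  rw [this, Nat.totient_prime_pow_succ hp] at hte
  apply Nat.eq_of_mul_eq_mul_left (show 0 < p ^ s from pow_pos hp.pos _)
  rw [← mul_assoc, ← pow_add, hte]; ring

theorem m_odd (x y z m n : ℕ) (hx : 0 < x) (hy : 0 < y) (hz : 0 < z)
    (hm : 0 < m) (hn : 0 < n) (hxy : y < x) (hzxy : z ≤ x - y)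
    (hgcd : Nat.gcd m n = 1) (hmn : n < m)
    (heq : Nat.totient (z * ((x ^ m - y ^ m) / (x - y))) =
      z * ((x ^ n - y ^ n) / (x - y))) :
    Odd m := by
  by_contra hodd
  have hme : Even m := Nat.not_odd_iff_even.1 hodd
  have hno : Odd n := by
    by_contra hne
    have := Nat.dvd_gcd hme.two_dvd (Nat.not_odd_iff_even.1 hne).two_dvd
    rw [hgcd] at this
    omega
  rw [lucU_eq _ _ _ hxy, lucU_eq _ _ _ hxy] at heq
  obtain ⟨d, x', y', hd, hcop, rfl, rfl⟩ : ∃ d x' y', 0 < d ∧ Nat.Coprime x' y' ∧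
      x = d * x' ∧ y = d * y' := by
    obtain ⟨g, x', y', hd, hc, h1, h2⟩ := Nat.exists_coprime' (Nat.gcd_pos_of_pos_left y hx)
    exact ⟨_, x', y', hd, hc, by rw [mul_comm]; exact h1, by rw [mul_comm]; exact h2⟩
  have hx' : 0 < x' := Nat.pos_of_mul_pos_left hx
  have hy' : 0 < y' := Nat.pos_of_mul_pos_left hy
  have hxy' : y' < x' := Nat.lt_of_mul_lt_mul_left hxy
  have hne : ¬ (Even x' ∧ Even y') := by
    rintro ⟨h1, h2⟩
    have := Nat.dvd_gcd h1.two_dvd h2.two_dvd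
    rw [hcop] at this
    omega
  obtain ⟨j, rfl⟩ := hno
  have hV := lucU_odd x' y' hne j
  obtain ⟨t, rfl⟩ := Nat.exists_eq_add_of_lt hmn
  rw [lucU_scale, lucU_scale] at heq
  have hW : 3 ≤ lucU x' y' (2 * j + 1 + t + 1) := by
    have := lucU_ge x' y' (2 * j + t) hx'
    rw [show 2 * j + 1 + t + 1 = 2 * j + t + 2 by ring]
    omega
  obtain ⟨hRe, p, c, hp, hpo, hT, hpV⟩ := key (z * d ^ (2 * j))
    (d ^ (t + 1) * lucU x' y' (2 * j + 1 + t + 1)) (lucU x' y' (2 * j + 1))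
    (by positivity)
    (by
      have : 0 < d ^ (t + 1) := by positivity
      nlinarith) hV
    (by
      rw [mul_assoc z _ (lucU x' y' (2 * j + 1)), ← heq]
      congr 1
      ring)
  obtain ⟨k, hk⟩ := hme
  rw [← two_mul] at hk
  have hdbl := lucU_double x' y' k hxy'
  rw [← hk] at hdbl
  have hWd : lucU x' y' (2 * j + 1 + t + 1) ∣ p ^ (c + 1) := ⟨_, by rw [← hT, mul_comm]⟩
  rcases Nat.lt_or_ge 1 k with hk1 | hk1
  · have hpd : ∀ q, q ∣ p ^ (c + 1) → q ≠ 1 → p ∣ q := by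
      intro q hq hq1
      obtain ⟨s, -, rfl⟩ := (Nat.dvd_prime_pow hp).1 hq
      exact dvd_pow_self p (by rintro rfl; simp at hq1)
    have h1 : p ∣ lucU x' y' k := by
      apply hpd _ (dvd_trans ⟨_, hdbl⟩ hWd)
      obtain ⟨i, rfl⟩ := Nat.exists_eq_add_of_le' hk1
      have := lucU_ge x' y' i hx'
      change lucU x' y' (i + 2) ≠ 1
      omega
    have h2 : p ∣ x' ^ k + y' ^ k := by
      apply hpd _ (dvd_trans (Dvd.intro_left _ hdbl.symm) hWd)
      have a1 : 0 < x' ^ k := by positivity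
      have a2 : 0 < y' ^ k := by positivity
      omega
    have h3 : x' ^ k = y' ^ k + (x' - y') * lucU x' y' k := by
      have := lucU_spec y' (x' - y') k
      rwa [Nat.add_sub_cancel' hxy'.le] at this
    have hp2 : ¬ p ∣ 2 := by
      intro h
      have := (Nat.prime_dvd_prime_iff_eq hp Nat.prime_two).1 h
      subst this
      revert hpo; decide
    have h4 : p ∣ y' ^ k := by
      rw [h3, show y' ^ k + (x' - y') * lucU x' y' k + y' ^ k =
        (x' - y') * lucU x' y' k + 2 * y' ^ k by ring] at h2
      have := (Nat.dvd_add_right (dvd_mul_of_dvd_right h1 _)).1 h2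
      exact (hp.dvd_mul.1 this).resolve_left hp2
    have h5 : p ∣ x' ^ k := by
      rw [h3]; exact dvd_add h4 (dvd_mul_of_dvd_right h1 _)
    have := Nat.dvd_gcd (hp.dvd_of_dvd_pow h5) (hp.dvd_of_dvd_pow h4)
    rw [hcop] at this
    exact hp.one_lt.ne' (Nat.dvd_one.1 this)
  · have hj : j = 0 := by omega
    have ht : t = 0 := by omega
    subst hj ht
    simp [lucU] at hT hpV hRe
    have hp3 : 3 ≤ p := by
      have := hp.two_le; obtain ⟨r, hr⟩ := hpo; omega
    have hc : c = 0 := by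
      by_contra hc
      have := Nat.le_self_pow hc p
      have h2 : 2 ≤ p - 1 := by omega
      nlinarith
    subst hc
    have hp' : p = 3 := by simp at hpV; omega
    subst hp'
    have : d * x' + d * y' = 3 := by rw [← mul_add, hT]; norm_num
    obtain ⟨r, hr⟩ := hRe
    omega
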